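/- Let n ≥ 1, β ∈ ℂ, and let L, U be real n×n matrices with L i j ≤ U i j entrywise. Then for any complex n×n Hermitian matrix P, the supremum over A ∈ 𝒜 of λ_max(M(P, A)) equals the maximum over the (finite, nonempty) vertex set 𝒱 of λ_max(M(P, V)). -/

import Mathlib

open Matrix

/-- `M(P, A) := β • (P * A) + (conj β) • (Aᵀ * P)`, with the real matrix `A`
coerced entrywise to `ℂ`. -/
noncomputable def Mmat {n : ℕ} (β : ℂ) (P : Matrix (Fin n) (Fin n) ℂ)
    (A : Matrix (Fin n) (Fin n) ℝ) : Matrix (Fin n) (Fin n) ℂ :=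
  β • (P * A.map Complex.ofReal) + (starRingEnd ℂ β) • ((A.map Complex.ofReal)ᵀ * P)

/-- The largest eigenvalue of a Hermitian complex matrix (junk value `0` for
non-Hermitian matrices). -/
noncomputable def lamMax {n : ℕ} (N : Matrix (Fin n) (Fin n) ℂ) : ℝ :=
  if h : N.IsHermitian then ⨆ i, h.eigenvalues i else 0

/-- `Mmat β P A` is Hermitian whenever `P` is. -/
theorem isHermitian_Mmat {n : ℕ} (β : ℂ) {P : Matrix (Fin n) (Fin n) ℂ} (hP : P.IsHermitian)
    (A : Matrix (Fin n) (Fin n) ℝ) : (Mmat β P A).IsHermitian := by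
  have hA : (A.map Complex.ofReal)ᴴ = (A.map Complex.ofReal)ᵀ := by
    ext i j; simp
  have hA' : ((A.map Complex.ofReal)ᵀ)ᴴ = A.map Complex.ofReal := by
    rw [← hA, conjTranspose_conjTranspose]
  unfold Matrix.IsHermitian Mmat
  rw [conjTranspose_add, conjTranspose_smul, conjTranspose_smul, conjTranspose_mul,
    conjTranspose_mul, hA, hA', hP.eq, add_comm]
  simp

open scoped ComplexOrder in
/-- The Rayleigh quotient of a Hermitian matrix is bounded by its largest eigenvalue. -/
theorem re_dotProduct_mulVec_le_lamMax {n : ℕ} {N : Matrix (Fin n) (Fin n) ℂ}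
    (hN : N.IsHermitian) {x : Fin n → ℂ} (hx : star x ⬝ᵥ x = 1) :
    (star x ⬝ᵥ N *ᵥ x).re ≤ lamMax N := by
  have hle : ∀ i, hN.eigenvalues i ≤ lamMax N := fun i => by
    rw [lamMax, dif_pos hN]
    exact le_ciSup (Set.finite_range _).bddAbove i
  set W : Matrix (Fin n) (Fin n) ℂ := (hN.eigenvectorUnitary : Matrix (Fin n) (Fin n) ℂ)
  have hWW : W * Wᴴ = 1 := Unitary.mul_star_self_of_mem hN.eigenvectorUnitary.2
  have hdiag : (diagonal fun i => ((lamMax N - hN.eigenvalues i : ℝ) : ℂ)).PosSemidef := by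
    refine PosSemidef.diagonal fun i => ?_
    simpa using hle i
  have hsplit : (diagonal fun i => ((lamMax N - hN.eigenvalues i : ℝ) : ℂ)) =
      (lamMax N : ℂ) • (1 : Matrix (Fin n) (Fin n) ℂ) -
        diagonal (RCLike.ofReal ∘ hN.eigenvalues) := by
    ext i j
    by_cases h : i = j <;> simp [h, diagonal]
  have hspec : N = W * diagonal (RCLike.ofReal ∘ hN.eigenvalues) * Wᴴ := by
    conv_lhs => rw [hN.spectral_theorem]
    rfl
  have key := (hdiag.mul_mul_conjTranspose_same W).re_dotProduct_nonneg x
  rw [hsplit, mul_sub, sub_mul, ← hspec, mul_smul_comm, smul_mul_assoc, mul_one, hWW, sub_mulVec,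
    dotProduct_sub, smul_mulVec, one_mulVec, dotProduct_smul, hx] at key
  simpa using key

/-- The largest eigenvalue of a Hermitian matrix is attained by the Rayleigh quotient. -/
theorem exists_re_dotProduct_mulVec_eq_lamMax {n : ℕ} (hn : 1 ≤ n)
    {N : Matrix (Fin n) (Fin n) ℂ} (hN : N.IsHermitian) :
    ∃ x : Fin n → ℂ, star x ⬝ᵥ x = 1 ∧ (star x ⬝ᵥ N *ᵥ x).re = lamMax N := by
  have : Nonempty (Fin n) := ⟨⟨0, hn⟩⟩
  obtain ⟨i, hi⟩ := exists_eq_ciSup_of_finite (f := hN.eigenvalues)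
  have hx : star (hN.eigenvectorBasis i).ofLp ⬝ᵥ (hN.eigenvectorBasis i).ofLp = 1 := by
    have h := hN.eigenvectorBasis.orthonormal.1 i
    have h2 := inner_self_eq_norm_sq_to_K (𝕜 := ℂ) (hN.eigenvectorBasis i)
    rw [h, EuclideanSpace.inner_eq_star_dotProduct, dotProduct_comm] at h2
    simpa using h2
  refine ⟨(hN.eigenvectorBasis i).ofLp, hx, ?_⟩
  rw [hN.mulVec_eigenvectorBasis, dotProduct_smul, hx, lamMax, dif_pos hN, ← hi]
  simp

/-- The real quadratic form of `Mmat β P A` at `x`, as a linear function of `A`. -/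
noncomputable def quadFormMmat {n : ℕ} (β : ℂ) (P : Matrix (Fin n) (Fin n) ℂ) (x : Fin n → ℂ) :
    Matrix (Fin n) (Fin n) ℝ →ₗ[ℝ] ℝ where
  toFun A := (star x ⬝ᵥ Mmat β P A *ᵥ x).re
  map_add' A B := by
    have h : Mmat β P (A + B) = Mmat β P A + Mmat β P B := by
      have hAB : (A + B).map Complex.ofReal = A.map Complex.ofReal + B.map Complex.ofReal := by
        ext; simp
      simp only [Mmat, hAB, mul_add, transpose_add, add_mul, smul_add]
      abel
    rw [h, add_mulVec, dotProduct_add, Complex.add_re]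
  map_smul' r A := by
    have h : Mmat β P (r • A) = (r : ℂ) • Mmat β P A := by
      have hA : (r • A).map Complex.ofReal = (r : ℂ) • A.map Complex.ofReal := by
        ext; simp
      simp only [Mmat, hA, transpose_smul, smul_add, mul_smul_comm, smul_mul_assoc]
      rw [smul_comm β, smul_comm (starRingEnd ℂ β)]
    rw [h, smul_mulVec, dotProduct_smul]
    simp

/-- A linear functional on matrices is dominated on a box by its value at some vertex. -/
theorem exists_vertex_linearMap_ge {m n : Type*} [Fintype m] [Fintype n]
    (f : Matrix m n ℝ →ₗ[ℝ] ℝ) (L U : Matrix m n ℝ) :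
    ∃ V : Matrix m n ℝ, (∀ i j, V i j = L i j ∨ V i j = U i j) ∧
      ∀ A : Matrix m n ℝ, (∀ i j, L i j ≤ A i j ∧ A i j ≤ U i j) → f A ≤ f V := by
  classical
  have hf : ∀ A, f A = ∑ i, ∑ j, A i j * f (single i j 1) := fun A => by
    conv_lhs => rw [matrix_eq_sum_single A]
    simp only [map_sum]
    refine Finset.sum_congr rfl fun i _ => Finset.sum_congr rfl fun j _ => ?_
    rw [← smul_eq_mul, ← map_smul, smul_single, smul_eq_mul, mul_one]
  refine ⟨of fun i j => if 0 ≤ f (single i j 1) then U i j else L i j, fun i j => ?_,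
    fun A hA => ?_⟩
  · rw [of_apply]
    split_ifs <;> simp
  · rw [hf A, hf (of _)]
    refine Finset.sum_le_sum fun i _ => Finset.sum_le_sum fun j _ => ?_
    rw [of_apply]
    split_ifs with h
    · exact mul_le_mul_of_nonneg_right (hA i j).2 h
    · exact mul_le_mul_of_nonpos_right (hA i j).1 (not_le.mp h).le

theorem stmt_6 (n : ℕ) (hn : 1 ≤ n) (β : ℂ)
    (L U : Matrix (Fin n) (Fin n) ℝ) (hLU : ∀ i j, L i j ≤ U i j)
    (P : Matrix (Fin n) (Fin n) ℂ) (hP : P.IsHermitian) :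
    ∃ V ∈ {A : Matrix (Fin n) (Fin n) ℝ | ∀ i j, A i j = L i j ∨ A i j = U i j},
      (∀ W ∈ {A : Matrix (Fin n) (Fin n) ℝ | ∀ i j, A i j = L i j ∨ A i j = U i j},
          lamMax (Mmat β P W) ≤ lamMax (Mmat β P V)) ∧
        sSup ((fun A => lamMax (Mmat β P A)) ''
            {A : Matrix (Fin n) (Fin n) ℝ | ∀ i j, L i j ≤ A i j ∧ A i j ≤ U i j}) =
          lamMax (Mmat β P V) := by
  have hfin : {A : Matrix (Fin n) (Fin n) ℝ | ∀ i j, A i j = L i j ∨ A i j = U i j}.Finite :=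
    Set.Finite.pi' fun i => Set.Finite.pi' fun j => Set.toFinite {L i j, U i j}
  obtain ⟨V, hV, hmax⟩ := Set.exists_max_image _ (fun A => lamMax (Mmat β P A)) hfin
    ⟨L, fun _ _ => Or.inl rfl⟩
  refine ⟨V, hV, hmax, IsGreatest.csSup_eq ⟨⟨V, fun i j => ?_, rfl⟩, ?_⟩⟩
  · rcases hV i j with h | h <;> rw [h]
    exacts [⟨le_rfl, hLU i j⟩, ⟨hLU i j, le_rfl⟩]
  · rintro _ ⟨A, hA, rfl⟩
    obtain ⟨x, hx, hxA⟩ := exists_re_dotProduct_mulVec_eq_lamMax hn (isHermitian_Mmat β hP A)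
    obtain ⟨W, hW, hAW⟩ := exists_vertex_linearMap_ge (quadFormMmat β P x) L U
    calc lamMax (Mmat β P A) = quadFormMmat β P x A := hxA.symm
      _ ≤ quadFormMmat β P x W := hAW A hA
      _ ≤ lamMax (Mmat β P W) := re_dotProduct_mulVec_le_lamMax (isHermitian_Mmat β hP W) hx
      _ ≤ lamMax (Mmat β P V) := hmax W hW
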